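/- arXiv:2402.15416 — 4 statements merged into one kernel-verified Lean document; each statement's English description precedes it below -/
import Mathlib

section
/- For the complete bipartite graph K_{m,n} with m ≥ 2 and n ≥ 2, the CN-signless Laplacian energy satisfies LE⁺_CN(K_{m,n}) = 4(m²(n-1) + n²(m-1))/(m+n); moreover for m = 1 and n ≥ 2, LE⁺_CN(K_{1,n}) = 2(n-1)(n+2)/(n+1). -/
set_option linter.unusedSectionVars false

open Matrix BigOperators Finset

namespace CNE

variable {V : Type*} [Fintype V]

/-- The common neighborhood matrix `CN(G)`. -/
noncomputable def cn [DecidableEq V] (G : SimpleGraph V) : Matrix V V ℝ :=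
  Matrix.of fun i j => if i = j then 0 else (Nat.card (G.commonNeighbors i j) : ℝ)

/-- The common neighborhood row sum (diagonal) matrix `CNRS(G)`. -/
noncomputable def cnrs [DecidableEq V] (G : SimpleGraph V) : Matrix V V ℝ :=
  Matrix.diagonal fun i => ∑ j, cn G i j

/-- The common neighborhood Laplacian matrix `CNL(G) = CNRS(G) - CN(G)`. -/
noncomputable def cnl [DecidableEq V] (G : SimpleGraph V) : Matrix V V ℝ :=
  cnrs G - cn G

/-- The common neighborhood signless Laplacian matrix `CNSL(G) = CNRS(G) + CN(G)`. -/
noncomputable def cnsl [DecidableEq V] (G : SimpleGraph V) : Matrix V V ℝ :=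
  cnrs G + cn G

lemma cn_isHermitian [DecidableEq V] (G : SimpleGraph V) : (cn G).IsHermitian := by
  ext i j
  simp only [Matrix.conjTranspose_apply, cn, Matrix.of_apply, star_trivial]
  rw [SimpleGraph.commonNeighbors_symm]
  by_cases h : i = j
  · simp [h]
  · rw [if_neg h, if_neg fun hji => h hji.symm]

lemma cnrs_isHermitian [DecidableEq V] (G : SimpleGraph V) : (cnrs G).IsHermitian :=
  Matrix.isHermitian_diagonal _

lemma cnl_isHermitian [DecidableEq V] (G : SimpleGraph V) : (cnl G).IsHermitian :=
  (cnrs_isHermitian G).sub (cn_isHermitian G)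

lemma cnsl_isHermitian [DecidableEq V] (G : SimpleGraph V) : (cnsl G).IsHermitian :=
  (cnrs_isHermitian G).add (cn_isHermitian G)

/-- The common neighborhood energy `E_CN(G)`: the sum of the absolute values of the
eigenvalues (with multiplicity) of `CN(G)`. -/
noncomputable def Ecn [DecidableEq V] (G : SimpleGraph V) : ℝ :=
  ∑ i, |(cn_isHermitian G).eigenvalues i|

/-- The common neighborhood Laplacian energy `LE_CN(G)`. -/
noncomputable def LEcn [DecidableEq V] (G : SimpleGraph V) : ℝ :=
  ∑ i, |(cnl_isHermitian G).eigenvalues i - (cnrs G).trace / (Fintype.card V : ℝ)|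

/-- The common neighborhood signless Laplacian energy `LE⁺_CN(G)`. -/
noncomputable def LEpcn [DecidableEq V] (G : SimpleGraph V) : ℝ :=
  ∑ i, |(cnsl_isHermitian G).eigenvalues i - (cnrs G).trace / (Fintype.card V : ℝ)|

open Classical in
/-- The (real) adjacency matrix of a graph, defined classically. -/
noncomputable def adjMat (G : SimpleGraph V) : Matrix V V ℝ :=
  Matrix.of fun i j => if G.Adj i j then 1 else 0

lemma adjMat_isHermitian (G : SimpleGraph V) : (adjMat G).IsHermitian := by
  ext i j
  simp only [Matrix.conjTranspose_apply, adjMat, Matrix.of_apply, star_trivial]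
  by_cases h : G.Adj i j
  · simp [h, h.symm]
  · have h' : ¬ G.Adj j i := fun hji => h hji.symm
    simp [h, h']

/-- The diagonal degree matrix of a graph. -/
noncomputable def degMat [DecidableEq V] (G : SimpleGraph V) : Matrix V V ℝ :=
  Matrix.diagonal fun v => (Nat.card (G.neighborSet v) : ℝ)

/-- The Laplacian matrix `L(G) = D(G) - A(G)`. -/
noncomputable def lap [DecidableEq V] (G : SimpleGraph V) : Matrix V V ℝ :=
  degMat G - adjMat G

/-- The signless Laplacian matrix `Q(G) = D(G) + A(G)`. -/
noncomputable def slap [DecidableEq V] (G : SimpleGraph V) : Matrix V V ℝ :=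
  degMat G + adjMat G

lemma degMat_isHermitian [DecidableEq V] (G : SimpleGraph V) : (degMat G).IsHermitian :=
  Matrix.isHermitian_diagonal _

lemma lap_isHermitian [DecidableEq V] (G : SimpleGraph V) : (lap G).IsHermitian :=
  (degMat_isHermitian G).sub (adjMat_isHermitian G)

lemma slap_isHermitian [DecidableEq V] (G : SimpleGraph V) : (slap G).IsHermitian :=
  (degMat_isHermitian G).add (adjMat_isHermitian G)

/-- The energy `E(G)` of a graph: the sum of the absolute values of the eigenvalues
(with multiplicity) of the adjacency matrix. -/
noncomputable def energy [DecidableEq V] (G : SimpleGraph V) : ℝ :=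
  ∑ i, |(adjMat_isHermitian G).eigenvalues i|

/-- The Laplacian energy `LE(G)`. -/
noncomputable def LE [DecidableEq V] (G : SimpleGraph V) : ℝ :=
  ∑ i, |(lap_isHermitian G).eigenvalues i - (degMat G).trace / (Fintype.card V : ℝ)|

/-- The signless Laplacian energy `LE⁺(G)`. -/
noncomputable def LEp [DecidableEq V] (G : SimpleGraph V) : ℝ :=
  ∑ i, |(slap_isHermitian G).eigenvalues i - (degMat G).trace / (Fintype.card V : ℝ)|

/-- The derived graph `G†`: two vertices are adjacent iff their distance in `G` is two. -/
def derivedGraph (G : SimpleGraph V) : SimpleGraph V where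
  Adj u v := G.dist u v = 2
  symm := by
    refine ⟨?_⟩
    intro u v h
    rwa [SimpleGraph.dist_comm]
  loopless := by
    refine ⟨?_⟩
    intro v h
    simp [SimpleGraph.dist_self] at h

open Polynomial in
lemma charpoly_blk (p : ℕ) (a c : ℝ) :
    (vecMulVec (fun _ : Fin (p+1) => c) (fun _ => (1:ℝ)) - Matrix.scalar _ (-a)).charpoly
      = (X - C a) ^ p * (X - C (a + c * (p + 1))) := by
  rw [Matrix.charpoly_sub_scalar, Matrix.charpoly_vecMulVec]
  simp [dotProduct, Polynomial.smul_eq_C_mul, pow_succ]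
  ring

lemma cn_cb (p q : ℕ) : cn (completeBipartiteGraph (Fin (p+1)) (Fin (q+1))) =
    fromBlocks (of fun i j => if i = j then 0 else (q+1:ℝ)) 0 0
      (of fun i j => if i = j then 0 else (p+1:ℝ)) := by
  ext i j
  rcases i with i | i <;> rcases j with j | j
  · have : (completeBipartiteGraph (Fin (p+1)) (Fin (q+1))).commonNeighbors (Sum.inl i) (Sum.inl j)
        = Set.range Sum.inr := by
      ext x; rcases x with x | x <;> simp [SimpleGraph.mem_commonNeighbors]
    simp only [cn, of_apply, fromBlocks_apply₁₁, this, Sum.inl.injEq]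
    rw [Nat.card_range_of_injective Sum.inr_injective]
    simp
  · have : (completeBipartiteGraph (Fin (p+1)) (Fin (q+1))).commonNeighbors (Sum.inl i) (Sum.inr j)
        = ∅ := by
      ext x; rcases x with x | x <;> simp [SimpleGraph.mem_commonNeighbors]
    simp [cn, this]
  · have : (completeBipartiteGraph (Fin (p+1)) (Fin (q+1))).commonNeighbors (Sum.inr i) (Sum.inl j)
        = ∅ := by
      ext x; rcases x with x | x <;> simp [SimpleGraph.mem_commonNeighbors]
    simp [cn, this]
  · have : (completeBipartiteGraph (Fin (p+1)) (Fin (q+1))).commonNeighbors (Sum.inr i) (Sum.inr j)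
        = Set.range Sum.inl := by
      ext x; rcases x with x | x <;> simp [SimpleGraph.mem_commonNeighbors]
    simp only [cn, of_apply, fromBlocks_apply₂₂, this, Sum.inr.injEq]
    rw [Nat.card_range_of_injective Sum.inl_injective]
    simp

lemma sum_off (p : ℕ) (i : Fin (p+1)) (c : ℝ) : ∑ j, (if i = j then 0 else c) = p * c := by
  have : ∀ j, (if i = j then 0 else c) = c - (if i = j then c else 0) := by
    intro j; split_ifs <;> simp
  simp_rw [this, Finset.sum_sub_distrib]
  simp
  ring

lemma cnrs_cb (p q : ℕ) : cnrs (completeBipartiteGraph (Fin (p+1)) (Fin (q+1))) =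
    diagonal (Sum.elim (fun _ => (p * (q+1) : ℝ)) (fun _ => (q * (p+1) : ℝ))) := by
  unfold cnrs
  congr 1
  ext i
  rw [cn_cb, Fintype.sum_sum_type]
  rcases i with i | i <;> simp [sum_off]

lemma cnsl_cb (p q : ℕ) : cnsl (completeBipartiteGraph (Fin (p+1)) (Fin (q+1))) =
    fromBlocks (vecMulVec (fun _ : Fin (p+1) => (q+1:ℝ)) (fun _ => (1:ℝ))
        - Matrix.scalar _ (-(((q:ℝ)+1)*((p:ℝ)-1)))) 0 0
      (vecMulVec (fun _ : Fin (q+1) => (p+1:ℝ)) (fun _ => (1:ℝ))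
        - Matrix.scalar _ (-(((p:ℝ)+1)*((q:ℝ)-1)))) := by
  unfold cnsl
  rw [cnrs_cb, cn_cb]
  ext i j
  rcases i with i | i <;> rcases j with j | j
  · by_cases h : i = j <;> simp [h, vecMulVec_apply, diagonal_apply]
    ring
  · simp
  · simp
  · by_cases h : i = j <;> simp [h, vecMulVec_apply, diagonal_apply]
    ring

lemma LEpcn_cb (p q : ℕ) (t : ℝ) (ht : t = (p+1)*(q+1)*(p+q) / (p+q+2)) :
    LEpcn (completeBipartiteGraph (Fin (p+1)) (Fin (q+1))) =
      p * |(q+1)*(p-1) - t| + |2*(q+1)*p - t| + q * |(p+1)*(q-1) - t| + |2*(p+1)*q - t| := by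
  have htr : (cnrs (completeBipartiteGraph (Fin (p+1)) (Fin (q+1)))).trace /
      (Fintype.card (Fin (p+1) ⊕ Fin (q+1)) : ℝ) = t := by
    rw [cnrs_cb, trace_diagonal, Fintype.sum_sum_type, ht]
    simp
    congr 1 <;> ring
  unfold LEpcn
  rw [htr]
  set h := cnsl_isHermitian (completeBipartiteGraph (Fin (p+1)) (Fin (q+1)))
  have h1 := h.roots_charpoly_eq_eigenvalues
  have h2 : ∑ i, |h.eigenvalues i - t| =
      ((cnsl (completeBipartiteGraph (Fin (p+1)) (Fin (q+1)))).charpoly.roots.map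
        fun x => |x - t|).sum := by
    rw [h1, Multiset.map_map]; rfl
  rw [h2, cnsl_cb, charpoly_fromBlocks_zero₁₂, charpoly_blk, charpoly_blk]
  have n1 : ∀ a : ℝ, (Polynomial.X - Polynomial.C a) ≠ 0 := Polynomial.X_sub_C_ne_zero
  rw [Polynomial.roots_mul, Polynomial.roots_mul, Polynomial.roots_mul]
  · simp only [Polynomial.roots_pow, Polynomial.roots_X_sub_C, Multiset.map_add, Multiset.sum_add,
      Multiset.map_nsmul, Multiset.sum_nsmul, Multiset.map_singleton, Multiset.sum_singleton,
      nsmul_eq_mul]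
    ring_nf
  · exact mul_ne_zero (pow_ne_zero _ (n1 _)) (n1 _)
  · exact mul_ne_zero (pow_ne_zero _ (n1 _)) (n1 _)
  · exact mul_ne_zero (mul_ne_zero (pow_ne_zero _ (n1 _)) (n1 _))
      (mul_ne_zero (pow_ne_zero _ (n1 _)) (n1 _))

lemma abs_small (p q : ℝ) (hp : 0 ≤ p) (hq : 0 ≤ q) :
    |(q+1)*(p-1) - (p+1)*(q+1)*(p+q) / (p+q+2)| = 2*(q+1)^2/(p+q+2) := by
  have h : (q+1)*(p-1) - (p+1)*(q+1)*(p+q) / (p+q+2) = -(2*(q+1)^2/(p+q+2)) := by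
    field_simp
    ring
  rw [h, abs_neg, abs_of_nonneg (by positivity)]

lemma abs_big (p q : ℝ) (hp : 1 ≤ p) (hq : 0 ≤ q) :
    |2*(q+1)*p - (p+1)*(q+1)*(p+q) / (p+q+2)| = (q+1)*((p+1)^2+(q+1)*(p-1))/(p+q+2) := by
  have h0 : 0 < p + q + 2 := by linarith
  have h : 2*(q+1)*p - (p+1)*(q+1)*(p+q) / (p+q+2) = (q+1)*((p+1)^2+(q+1)*(p-1))/(p+q+2) := by
    field_simp
    ring
  have : 0 ≤ p - 1 := by linarith
  rw [h, abs_of_nonneg (by positivity)]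

theorem statement5 (m n : ℕ) :
    (2 ≤ m → 2 ≤ n → LEpcn (completeBipartiteGraph (Fin m) (Fin n)) =
      4 * ((m : ℝ) ^ 2 * ((n : ℝ) - 1) + (n : ℝ) ^ 2 * ((m : ℝ) - 1)) / ((m : ℝ) + (n : ℝ))) ∧
    (2 ≤ n → LEpcn (completeBipartiteGraph (Fin 1) (Fin n)) =
      2 * ((n : ℝ) - 1) * ((n : ℝ) + 2) / ((n : ℝ) + 1)) := by
  have comm : ∀ p q : ℝ, (p+1)*(q+1)*(p+q) / (p+q+2) = (q+1)*(p+1)*(q+p) / (q+p+2) := by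
    intro p q; congr 1 <;> ring
  constructor
  · intro hm hn
    obtain ⟨p, rfl⟩ : ∃ p, m = p + 1 := ⟨m - 1, by omega⟩
    obtain ⟨q, rfl⟩ : ∃ q, n = q + 1 := ⟨n - 1, by omega⟩
    have hp : (1:ℝ) ≤ p := by exact_mod_cast (by omega : 1 ≤ p)
    have hq : (1:ℝ) ≤ q := by exact_mod_cast (by omega : 1 ≤ q)
    rw [LEpcn_cb p q _ rfl, abs_small _ _ (by linarith) (by linarith),
      abs_big _ _ hp (by linarith), comm, abs_small _ _ (by linarith) (by linarith),
      abs_big _ _ hq (by linarith)]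
    push_cast
    have e1 : (q:ℝ) + p + 2 = p + q + 2 := by ring
    have e2 : (p:ℝ) + 1 + (q + 1) = p + q + 2 := by ring
    rw [e1, e2]
    field_simp
    ring
  · intro hn
    obtain ⟨q, rfl⟩ : ∃ q, n = q + 1 := ⟨n - 1, by omega⟩
    have hq : (1:ℝ) ≤ q := by exact_mod_cast (by omega : 1 ≤ q)
    have key := LEpcn_cb 0 q _ rfl
    rw [comm, abs_small _ _ (by linarith) (by simp),
      abs_big _ _ hq (by simp)] at key
    have h3 : |2 * ((q:ℝ) + 1) * ((0:ℕ):ℝ) - (q + 1) * (((0:ℕ):ℝ) + 1) * (q + ((0:ℕ):ℝ)) / (q + ((0:ℕ):ℝ) + 2)|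
        = (q+1)*q/(q+2) := by
      simp only [Nat.cast_zero, mul_zero, zero_sub, abs_neg, zero_add, add_zero, mul_one]
      rw [abs_of_nonneg (by positivity)]
    rw [h3] at key
    refine key.trans ?_
    push_cast
    have e2 : (q:ℝ) + 1 + 1 = q + 2 := by ring
    rw [e2]
    simp only [zero_mul, zero_add, add_zero]
    field_simp
    ring

end CNE
end

section
/- For any finite simple graph G with |e(G)| edges, the common neighborhood energy satisfies E_CN(G) ≤ E(G)² + 2|e(G)|, where E(G) is the energy of G. -/
set_option linter.unusedSectionVars false

open Matrix BigOperators Finset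

namespace CNE

variable {V : Type*} [Fintype V]

lemma aux_conj [DecidableEq V] {M : Matrix V V ℝ} (hM : M.IsHermitian) :
    ∃ U : Matrix V V ℝ, Uᴴ * U = 1 ∧ U * Uᴴ = 1 ∧ Uᴴ * M * U = diagonal hM.eigenvalues := by
  refine ⟨hM.eigenvectorUnitary, ?_, ?_, ?_⟩
  · exact Unitary.coe_star_mul_self hM.eigenvectorUnitary
  · exact Unitary.coe_mul_star_self hM.eigenvectorUnitary
  · have := hM.conjStarAlgAut_star_eigenvectorUnitary
    rw [Unitary.conjStarAlgAut_apply] at this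
    simpa [star_eq_conjTranspose, Function.comp_def] using this

lemma aux_trace [DecidableEq V] (M U : Matrix V V ℝ) (h : U * Uᴴ = 1) :
    (Uᴴ * M * U).trace = M.trace := by
  rw [Matrix.trace_mul_comm, ← mul_assoc, h, one_mul]

lemma aux_sq [DecidableEq V] {M : Matrix V V ℝ} (hM : M.IsHermitian) :
    (M * M).trace = ∑ i, hM.eigenvalues i ^ 2 := by
  obtain ⟨U, h1, h2, h3⟩ := aux_conj hM
  have : Uᴴ * (M * M) * U = (Uᴴ * M * U) * (Uᴴ * M * U) := by
    calc Uᴴ * (M * M) * U = Uᴴ * M * 1 * (M * U) := by simp only [mul_assoc, mul_one, one_mul]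
      _ = _ := by rw [← h2]; simp only [mul_assoc]
  rw [← aux_trace (M * M) U h2, this, h3, diagonal_mul_diagonal, trace_diagonal]
  simp [sq]

lemma aux_diff [DecidableEq V] {M P Q : Matrix V V ℝ} (hM : M.IsHermitian)
    (hP : P.PosSemidef) (hQ : Q.PosSemidef) (h : M = P - Q) :
    ∑ i, |hM.eigenvalues i| ≤ P.trace + Q.trace := by
  obtain ⟨U, h1, h2, h3⟩ := aux_conj hM
  rw [← aux_trace P U h2, ← aux_trace Q U h2, Matrix.trace, Matrix.trace, ← Finset.sum_add_distrib]
  refine Finset.sum_le_sum fun i _ => ?_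
  have e : hM.eigenvalues i = (Uᴴ * P * U) i i - (Uᴴ * Q * U) i i := by
    have := congrFun (congrFun h3 i) i
    rw [diagonal_apply_eq] at this
    rw [← this, ← Matrix.sub_apply, ← Matrix.sub_mul, ← Matrix.mul_sub, ← h]
  have p := (hP.conjTranspose_mul_mul_same U).diag_nonneg (i := i)
  have q := (hQ.conjTranspose_mul_mul_same U).diag_nonneg (i := i)
  simp only [Matrix.diag_apply]
  rw [e, abs_le]
  constructor <;> linarith

lemma aux_cn [DecidableEq V] (G : SimpleGraph V) :
    cn G = adjMat G * adjMat G - degMat G := by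
  classical
  ext i j
  have key : (adjMat G * adjMat G) i j = (Nat.card (G.commonNeighbors i j) : ℝ) := by
    rw [Matrix.mul_apply, Nat.card_eq_fintype_card, ← Set.toFinset_card]
    simp only [adjMat, Matrix.of_apply, ← ite_and, mul_ite, mul_one, mul_zero]
    rw [Finset.sum_boole]
    congr 2
    ext k
    simp [SimpleGraph.mem_commonNeighbors, G.adj_comm k j, and_comm]
  rw [Matrix.sub_apply, key]
  by_cases h : i = j
  · subst h
    simp [cn, degMat, SimpleGraph.commonNeighbors]
  · simp [cn, degMat, h]

theorem statement11 [DecidableEq V] (G : SimpleGraph V) [DecidableRel G.Adj] :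
    Ecn G ≤ (energy G) ^ 2 + 2 * (G.edgeFinset.card : ℝ) := by
  have hA := adjMat_isHermitian G
  have hP : (adjMat G * adjMat G).PosSemidef := by
    have := posSemidef_conjTranspose_mul_self (adjMat G)
    rwa [hA.eq] at this
  have hQ : (degMat G).PosSemidef := PosSemidef.diagonal fun i => Nat.cast_nonneg _
  have h1 := aux_diff (cn_isHermitian G) hP hQ (aux_cn G)
  have h2 : (degMat G).trace = 2 * (G.edgeFinset.card : ℝ) := by
    have := G.sum_degrees_eq_twice_card_edges
    rw [degMat, trace_diagonal]
    have h3 : ∀ v, Nat.card (G.neighborSet v) = G.degree v := fun v => by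
      rw [Nat.card_eq_fintype_card, SimpleGraph.card_neighborSet_eq_degree]
    simp only [h3]
    exact_mod_cast this
  have h4 : (adjMat G * adjMat G).trace ≤ energy G ^ 2 := by
    rw [aux_sq hA, energy]
    calc ∑ i, hA.eigenvalues i ^ 2 = ∑ i, |hA.eigenvalues i| ^ 2 := by simp
      _ ≤ _ := Finset.sum_sq_le_sq_sum_of_nonneg fun i _ => abs_nonneg _
  rw [h2] at h1
  unfold Ecn
  linarith

end CNE
end

section
/- Let G be a finite simple graph containing no cycle of length 3 and no cycle of length 4 (triangle- and quadrangle-free). Then LE_CN(G) = LE(G†) and LE⁺_CN(G) = LE⁺(G†), where G† is the derived graph of G. -/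
set_option linter.unusedSectionVars false

open Matrix BigOperators Finset

namespace CNE

variable {V : Type*} [Fintype V]

lemma cn_eq_adjMat [DecidableEq V] (G : SimpleGraph V)
    (h : ∀ (v : V) (c : G.Walk v v), c.IsCycle → c.length ≠ 3 ∧ c.length ≠ 4) :
    cn G = adjMat (derivedGraph G) := by
  classical
  have tri : ∀ a b c : V, G.Adj a b → G.Adj b c → G.Adj c a → False := by
    intro a b c hab hbc hca
    refine (h a (.cons hab (.cons hbc (.cons hca .nil))) ?_).1 (by simp)
    rw [SimpleGraph.Walk.cons_isCycle_iff]
    have := hab.ne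
    have := hbc.ne
    have := hca.ne
    simp [SimpleGraph.Walk.cons_isPath_iff, *, Ne.symm]
  have quad : ∀ a b c d : V, G.Adj a b → G.Adj b c → G.Adj c d → G.Adj d a →
      a ≠ c → b ≠ d → False := by
    intro a b c d hab hbc hcd hda hac hbd
    refine (h a (.cons hab (.cons hbc (.cons hcd (.cons hda .nil)))) ?_).2 (by simp)
    rw [SimpleGraph.Walk.cons_isCycle_iff]
    have := hab.ne
    have := hbc.ne
    have := hcd.ne
    have := hda.ne
    simp [SimpleGraph.Walk.cons_isPath_iff, *, Ne.symm]
  ext i j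
  simp only [cn, adjMat, Matrix.of_apply, derivedGraph]
  by_cases hij : i = j
  · subst hij
    simp
  rw [if_neg hij]
  by_cases hd : G.dist i j = 2
  · have hr : G.Reachable i j := by
      by_contra hr
      rw [SimpleGraph.dist_eq_zero_of_not_reachable hr] at hd
      omega
    obtain ⟨w, hw⟩ := hr.exists_walk_length_eq_dist
    rw [hd] at hw
    obtain ⟨k, hik, hkj⟩ : ∃ k, G.Adj i k ∧ G.Adj k j := by
      match w, hw with
      | .cons h1 (.cons h2 .nil), _ => exact ⟨_, h1, h2⟩
    have : G.commonNeighbors i j = {k} := by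
      ext l
      simp only [SimpleGraph.mem_commonNeighbors, Set.mem_singleton_iff]
      constructor
      · rintro ⟨h1, h2⟩
        by_contra hl
        exact quad i l j k h1 h2.symm hkj.symm hik.symm hij hl
      · rintro rfl
        exact ⟨hik, hkj.symm⟩
    rw [this]
    simp [hd]
  · have : G.commonNeighbors i j = ∅ := by
      ext l
      simp only [SimpleGraph.mem_commonNeighbors, Set.mem_empty_iff_false, iff_false]
      rintro ⟨h1, h2⟩
      apply hd
      have hle : G.dist i j ≤ 2 :=
        SimpleGraph.dist_le (SimpleGraph.Walk.cons h1 (.cons h2.symm .nil))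
      have h0 : G.dist i j ≠ 0 := by
        have hr : G.Reachable i j := ⟨SimpleGraph.Walk.cons h1 (.cons h2.symm .nil)⟩
        exact fun h0 => hij (hr.dist_eq_zero_iff.1 h0)
      have h1' : G.dist i j ≠ 1 := fun hh =>
        tri i l j h1 h2.symm (SimpleGraph.dist_eq_one_iff_adj.1 hh).symm
      omega
    rw [this]
    simp [hd]

lemma cnrs_eq_degMat [DecidableEq V] (G : SimpleGraph V)
    (h : ∀ (v : V) (c : G.Walk v v), c.IsCycle → c.length ≠ 3 ∧ c.length ≠ 4) :
    cnrs G = degMat (derivedGraph G) := by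
  classical
  unfold cnrs degMat
  rw [cn_eq_adjMat G h]
  congr 1
  ext i
  simp only [adjMat, Matrix.of_apply, Finset.sum_boole]
  rw [Nat.card_eq_fintype_card, SimpleGraph.card_neighborSet_eq_degree,
    ← SimpleGraph.card_neighborFinset_eq_degree, SimpleGraph.neighborFinset_eq_filter]

theorem statement16 [DecidableEq V] (G : SimpleGraph V)
    (h : ∀ (v : V) (c : G.Walk v v), c.IsCycle → c.length ≠ 3 ∧ c.length ≠ 4) :
    LEcn G = LE (derivedGraph G) ∧ LEpcn G = LEp (derivedGraph G) := by
  have e1 : cnl G = lap (derivedGraph G) := by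
    rw [cnl, lap, cnrs_eq_degMat G h, cn_eq_adjMat G h]
  have e2 : cnsl G = slap (derivedGraph G) := by
    rw [cnsl, slap, cnrs_eq_degMat G h, cn_eq_adjMat G h]
  constructor
  · unfold LEcn LE
    rw [cnrs_eq_degMat G h]
    simp only [e1]
  · unfold LEpcn LEp
    rw [cnrs_eq_degMat G h]
    simp only [e2]

end CNE
end

section
/- Let G be a finite simple graph on n vertices with |e(G)| edges and first Zagreb index M1(G). Then LE_CN(G) ≤ Σ_{i=1}^{n} sqrt( (CNRS(G)_{i,i} - (M1(G) - 2|e(G)|)/n)² + Σ_{k ≠ i} |N_G(v_i) ∩ N_G(v_k)|² ), and the same upper bound holds for LE⁺_CN(G). -/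
set_option linter.unusedSectionVars false

open Matrix BigOperators Finset

namespace CNE

variable {V : Type*} [Fintype V]

lemma key_bound [DecidableEq V] {M : Matrix V V ℝ} (hM : M.IsHermitian) (c : ℝ) :
    ∑ j, |hM.eigenvalues j - c| ≤ ∑ i, Real.sqrt (∑ k, ((M - c • (1 : Matrix V V ℝ)) i k) ^ 2) := by
  set U : Matrix V V ℝ := (hM.eigenvectorUnitary : Matrix V V ℝ) with hU
  have h1 : U * Uᵀ = 1 := by
    have := (Matrix.mem_unitaryGroup_iff).1 hM.eigenvectorUnitary.2
    rwa [star_eq_conjTranspose, conjTranspose_eq_transpose_of_trivial] at this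
  have h2 : Uᵀ * U = 1 := by
    have := (Matrix.mem_unitaryGroup_iff').1 hM.eigenvectorUnitary.2
    rwa [star_eq_conjTranspose, conjTranspose_eq_transpose_of_trivial] at this
  have hrow : ∀ i, ∑ j, (U i j) ^ 2 = 1 := by
    intro i
    have := congrFun (congrFun h1 i) i
    simpa [Matrix.mul_apply, sq] using this
  have hcol : ∀ j, ∑ i, (U i j) ^ 2 = 1 := by
    intro j
    have := congrFun (congrFun h2 j) j
    simpa [Matrix.mul_apply, sq] using this
  set B := M - c • (1 : Matrix V V ℝ) with hB
  have hBU : ∀ i j, (B * U) i j = (hM.eigenvalues j - c) * U i j := by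
    intro i j
    have h := congrFun (hM.mulVec_eigenvectorBasis j) i
    have h' : (M * U) i j = hM.eigenvalues j * U i j := by
      simpa [Matrix.mul_apply, Matrix.mulVec, dotProduct, hU, Matrix.IsHermitian.eigenvectorUnitary_apply] using h
    rw [hB, Matrix.sub_mul, Matrix.sub_apply, h']
    simp [sub_mul]
  have hBB : ∀ i, ∑ j, ((hM.eigenvalues j - c) * U i j) ^ 2 = ∑ k, (B i k) ^ 2 := by
    intro i
    have h : (B * U) * (B * U)ᵀ = B * Bᵀ := by
      rw [Matrix.transpose_mul, Matrix.mul_assoc, ← Matrix.mul_assoc U, h1, Matrix.one_mul]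
    have := congrFun (congrFun h i) i
    rw [Matrix.mul_apply, Matrix.mul_apply] at this
    simp only [Matrix.transpose_apply, hBU] at this
    simpa [sq] using this
  calc ∑ j, |hM.eigenvalues j - c|
      = ∑ j, ∑ i, |hM.eigenvalues j - c| * (U i j) ^ 2 := by
        simp [← Finset.mul_sum, hcol]
    _ = ∑ i, ∑ j, |U i j| * |(hM.eigenvalues j - c) * U i j| := by
        rw [Finset.sum_comm]
        refine Finset.sum_congr rfl fun i _ => Finset.sum_congr rfl fun j _ => ?_
        rw [abs_mul, ← sq_abs (U i j)]; ring
    _ ≤ _ := by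
        refine Finset.sum_le_sum fun i _ => ?_
        have := Real.sum_mul_le_sqrt_mul_sqrt Finset.univ (fun j => |U i j|)
          (fun j => |(hM.eigenvalues j - c) * U i j|)
        simpa only [sq_abs, hrow, hBB, Real.sqrt_one, one_mul] using this

lemma trace_cnrs [DecidableEq V] (G : SimpleGraph V) [DecidableRel G.Adj] :
    (cnrs G).trace = (∑ v, (G.degree v : ℝ) ^ 2) - 2 * (G.edgeFinset.card : ℝ) := by
  have hc : ∀ i j, (Nat.card (G.commonNeighbors i j) : ℝ)
      = ∑ k, (if G.Adj k i then (1 : ℝ) else 0) * (if G.Adj k j then 1 else 0) := by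
    intro i j
    rw [Nat.card_eq_fintype_card, Fintype.card_subtype]
    simp [SimpleGraph.mem_commonNeighbors, ← ite_and, G.adj_comm]
    simp only [and_comm]
  have hd : ∀ k, ∑ i, (if G.Adj k i then (1 : ℝ) else 0) = G.degree k := by
    intro k
    simp [← SimpleGraph.card_neighborFinset_eq_degree, SimpleGraph.neighborFinset_eq_filter]
  have hs : ∑ i, ∑ j, (Nat.card (G.commonNeighbors i j) : ℝ) = ∑ v, (G.degree v : ℝ) ^ 2 := by
    simp only [hc]
    calc _ = ∑ i, ∑ k, ∑ j, (if G.Adj k i then (1 : ℝ) else 0) * (if G.Adj k j then 1 else 0) :=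
          Finset.sum_congr rfl fun i _ => Finset.sum_comm
      _ = ∑ k, ∑ i, ∑ j, (if G.Adj k i then (1 : ℝ) else 0) * (if G.Adj k j then 1 else 0) :=
          Finset.sum_comm
      _ = _ := by
          refine Finset.sum_congr rfl fun k _ => ?_
          rw [← Finset.sum_mul_sum, hd, sq]
  have hdiag : ∑ i, (Nat.card (G.commonNeighbors i i) : ℝ) = 2 * (G.edgeFinset.card : ℝ) := by
    have h := G.sum_degrees_eq_twice_card_edges
    have h' : (∑ v, (G.degree v : ℝ)) = 2 * (G.edgeFinset.card : ℝ) := by exact_mod_cast h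
    rw [← h']
    refine Finset.sum_congr rfl fun i _ => ?_
    rw [hc, ← hd]
    refine Finset.sum_congr rfl fun k _ => ?_
    by_cases h : G.Adj i k
    · simp [h, h.symm]
    · simp [h, G.adj_comm k i]
  rw [← hs, ← hdiag, ← Finset.sum_sub_distrib, cnrs, Matrix.trace_diagonal]
  refine Finset.sum_congr rfl fun i _ => ?_
  rw [← Finset.add_sum_erase _ _ (Finset.mem_univ i),
    ← Finset.add_sum_erase _ (fun j => (Nat.card (G.commonNeighbors i j) : ℝ)) (Finset.mem_univ i)]
  rw [add_sub_cancel_left]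
  simp only [cn, Matrix.of_apply, if_true, zero_add]
  refine Finset.sum_congr rfl fun j hj => ?_
  rw [if_neg (Finset.ne_of_mem_erase hj).symm]

lemma row_eq [DecidableEq V] (G : SimpleGraph V) (M : Matrix V V ℝ) (s c : ℝ) (hs : s ^ 2 = 1)
    (hM : M = cnrs G + s • cn G) (i : V) :
    ∑ k, ((M - c • (1 : Matrix V V ℝ)) i k) ^ 2 = (cnrs G i i - c) ^ 2 +
      ∑ k ∈ Finset.univ.erase i, (Nat.card (G.commonNeighbors i k) : ℝ) ^ 2 := by
  rw [← Finset.add_sum_erase _ _ (Finset.mem_univ i), hM]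
  congr 1
  · simp [cn]
  · refine Finset.sum_congr rfl fun j hj => ?_
    have h := (Finset.ne_of_mem_erase hj).symm
    simp [cn, cnrs, h, mul_pow, hs]

theorem statement19 [DecidableEq V] (G : SimpleGraph V) [DecidableRel G.Adj] :
    LEcn G ≤ ∑ i, Real.sqrt ((cnrs G i i -
          ((∑ v, (G.degree v : ℝ) ^ 2) - 2 * (G.edgeFinset.card : ℝ)) / (Fintype.card V : ℝ)) ^ 2 +
        ∑ k ∈ Finset.univ.erase i, (Nat.card (G.commonNeighbors i k) : ℝ) ^ 2) ∧
    LEpcn G ≤ ∑ i, Real.sqrt ((cnrs G i i -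
          ((∑ v, (G.degree v : ℝ) ^ 2) - 2 * (G.edgeFinset.card : ℝ)) / (Fintype.card V : ℝ)) ^ 2 +
        ∑ k ∈ Finset.univ.erase i, (Nat.card (G.commonNeighbors i k) : ℝ) ^ 2) := by
  rw [← trace_cnrs]
  constructor
  · refine (key_bound (cnl_isHermitian G) _).trans_eq (Finset.sum_congr rfl fun i _ => ?_)
    rw [row_eq G (cnl G) (-1) _ (by norm_num) (by simp [cnl, sub_eq_add_neg])]
  · refine (key_bound (cnsl_isHermitian G) _).trans_eq (Finset.sum_congr rfl fun i _ => ?_)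
    rw [row_eq G (cnsl G) 1 _ (by norm_num) (by simp [cnsl])]

end CNE
end
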